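/- arXiv:1507.00108 — 2 statements merged into one kernel-verified Lean document; each statement's English description precedes it below -/
import Mathlib

section
/- Fix α, τ, κ ∈ ℝ and ν > 1. Let Ψ_sk : ℝ → ℝ be the univariate non-central extended skew-t distribution function, Ψ_sk(x) = ∫_{−∞}^x ψ(u;ν) Ψ( (αu+τ) √((ν+1)/(ν+u²)); κ, ν+1 ) / Ψ( τ/√(1+α²); κ/√(1+α²), ν ) du. Then lim_{x→+∞} x^ν (1 − Ψ_sk(x)) = Γ((ν+1)/2) ν^{(ν−2)/2} Ψ(α√(ν+1); κ, ν+1) / ( √π Γ(ν/2) Ψ( τ/√(1+α²); κ/√(1+α²), ν ) ); that is, the non-central extended skew-t survival function is regularly varying at +∞ with index −ν and the stated tail constant. -/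
open MeasureTheory Real Filter Matrix Set Topology Asymptotics

noncomputable section

/-- Standard normal density. -/
def nPdf (x : ℝ) : ℝ := (Real.sqrt (2 * π))⁻¹ * Real.exp (-(x ^ 2) / 2)

/-- Standard normal distribution function. -/
def nCdf (x : ℝ) : ℝ := ∫ u in Set.Iio x, nPdf u

/-- Centred multivariate normal density with covariance matrix `S`. -/
def mvnPdf {ι : Type*} [Fintype ι] [DecidableEq ι] (S : Matrix ι ι ℝ) (y : ι → ℝ) : ℝ :=
  (2 * π) ^ (-(Fintype.card ι : ℝ) / 2) * S.det ^ (-(1 : ℝ) / 2) *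
    Real.exp (-(y ⬝ᵥ S⁻¹.mulVec y) / 2)

/-- Centred multivariate normal distribution function. -/
def mvnCdf {ι : Type*} [Fintype ι] [DecidableEq ι] (S : Matrix ι ι ℝ) (w : ι → ℝ) : ℝ :=
  ∫ u in Set.univ.pi fun i => Set.Iic (w i), mvnPdf S u

/-- Multivariate central Student-t density with scale matrix `S` and `ν` degrees of freedom. -/
def tPdf {ι : Type*} [Fintype ι] [DecidableEq ι] (S : Matrix ι ι ℝ) (ν : ℝ) (y : ι → ℝ) : ℝ :=
  Real.Gamma ((ν + Fintype.card ι) / 2) *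
      (1 + y ⬝ᵥ S⁻¹.mulVec y / ν) ^ (-(ν + Fintype.card ι) / 2) /
    (Real.Gamma (ν / 2) * (ν * π) ^ ((Fintype.card ι : ℝ) / 2) * Real.sqrt S.det)

/-- Univariate non-central t distribution function with non-centrality `a`. -/
def nctCdf (x a ν : ℝ) : ℝ :=
  ∫ v in Set.Ioi (0 : ℝ),
    v ^ (ν / 2 - 1) * Real.exp (-v) / Real.Gamma (ν / 2) *
      nCdf (x * Real.sqrt (2 * v / ν) - a)

/-- Multivariate non-central t distribution function. -/
def mvnctCdf {ι : Type*} [Fintype ι] [DecidableEq ι]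
    (y : ι → ℝ) (S : Matrix ι ι ℝ) (κ : ι → ℝ) (ν : ℝ) : ℝ :=
  ∫ v in Set.Ioi (0 : ℝ),
    v ^ (ν / 2 - 1) * Real.exp (-v) / Real.Gamma (ν / 2) *
      mvnCdf S fun i => y i * Real.sqrt (2 * v / ν) - κ i

/-- Multivariate non-central t density (scale-mixture form). -/
def mvnctPdf {ι : Type*} [Fintype ι] [DecidableEq ι]
    (μ : ι → ℝ) (S : Matrix ι ι ℝ) (κ : ι → ℝ) (ν : ℝ) (y : ι → ℝ) : ℝ :=
  ∫ v in Set.Ioi (0 : ℝ),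
    v ^ (ν / 2 - 1) * Real.exp (-v) / Real.Gamma (ν / 2) *
      ((2 * v / ν) ^ ((Fintype.card ι : ℝ) / 2) *
        mvnPdf S fun i => Real.sqrt (2 * v / ν) * (y i - μ i) - κ i)

/-- Univariate non-central t density with location `μ`, scale (standard deviation) `s`,
non-centrality `κ` and `ν` degrees of freedom. -/
def nctPdf1 (μ s κ ν x : ℝ) : ℝ :=
  ∫ v in Set.Ioi (0 : ℝ),
    v ^ (ν / 2 - 1) * Real.exp (-v) / Real.Gamma (ν / 2) *
      (Real.sqrt (2 * v / ν) * s⁻¹ * nPdf (Real.sqrt (2 * v / ν) * (x - μ) / s - κ))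

/-- Non-central extended skew-t density. -/
def skewTPdf {ι : Type*} [Fintype ι] [DecidableEq ι]
    (μ : ι → ℝ) (Ω : Matrix ι ι ℝ) (α : ι → ℝ) (τ κ ν : ℝ) (y : ι → ℝ) : ℝ :=
  let d : ℝ := Fintype.card ι
  let ω : Matrix ι ι ℝ := Matrix.diagonal fun i => Real.sqrt (Ω i i)
  let Ωb : Matrix ι ι ℝ := ω⁻¹ * Ω * ω⁻¹
  let z : ι → ℝ := ω⁻¹.mulVec fun i => y i - μ i
  let Q : ℝ := α ⬝ᵥ Ωb.mulVec α
  tPdf Ω ν (fun i => y i - μ i) *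
      nctCdf ((α ⬝ᵥ z + τ) * Real.sqrt ((ν + d) / (ν + z ⬝ᵥ Ωb⁻¹.mulVec z))) κ (ν + d) /
    nctCdf (τ / Real.sqrt (1 + Q)) (κ / Real.sqrt (1 + Q)) ν

/-- Non-central extended skew-t distribution function. -/
def skewTCdf {ι : Type*} [Fintype ι] [DecidableEq ι]
    (μ : ι → ℝ) (Ω : Matrix ι ι ℝ) (α : ι → ℝ) (τ κ ν : ℝ) (y : ι → ℝ) : ℝ :=
  ∫ u in Set.univ.pi fun i => Set.Iic (y i), skewTPdf μ Ω α τ κ ν u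


open ProbabilityTheory in
theorem nPdf_eq (x : ℝ) : nPdf x = gaussianPDFReal 0 1 x := by
  simp [nPdf, gaussianPDFReal]

open ProbabilityTheory in
theorem nCdf_eq (x : ℝ) : nCdf x = (gaussianReal 0 1).real (Set.Iio x) := by
  rw [measureReal_def, gaussianReal_apply_eq_integral _ (by norm_num), ENNReal.toReal_ofReal]
  · simp only [nCdf, nPdf_eq]
  · exact integral_nonneg fun y => gaussianPDFReal_nonneg _ _ _

theorem nCdf_nonneg (x : ℝ) : 0 ≤ nCdf x := by rw [nCdf_eq]; positivity

theorem nCdf_le_one (x : ℝ) : nCdf x ≤ 1 := by rw [nCdf_eq]; exact measureReal_le_one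

theorem nPdf_pos (x : ℝ) : 0 < nPdf x := by unfold nPdf; positivity

open ProbabilityTheory in
theorem nPdf_integrable : Integrable nPdf := by
  rw [show nPdf = gaussianPDFReal 0 1 from funext nPdf_eq]
  exact integrable_gaussianPDFReal _ _

theorem nCdf_pos (x : ℝ) : 0 < nCdf x := by
  unfold nCdf
  rw [integral_pos_iff_support_of_nonneg (fun y => (nPdf_pos y).le) nPdf_integrable.integrableOn]
  have : Function.support nPdf = Set.univ := by
    ext y; simp [(nPdf_pos y).ne']
  rw [this]; simp

theorem nCdf_cont : Continuous nCdf := by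
  have h : nCdf = fun x => (∫ u in Set.Iic (0:ℝ), nPdf u) + ∫ u in (0:ℝ)..x, nPdf u := by
    funext x
    have := intervalIntegral.integral_Iic_sub_Iic (f := nPdf) (a := 0) (b := x) (μ := volume)
      nPdf_integrable.integrableOn nPdf_integrable.integrableOn
    rw [← this, nCdf, integral_Iic_eq_integral_Iio (x := x)]; ring
  rw [h]
  exact continuous_const.add (intervalIntegral.continuous_primitive
    (fun a b => nPdf_integrable.intervalIntegrable) 0)

open ProbabilityTheory in
theorem gauss_mix (α b : ℝ) :
    ∫ z, nPdf z * nCdf (α * z + b) = nCdf (b / Real.sqrt (1 + α ^ 2)) := by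
  have hs : 0 < Real.sqrt (1 + α ^ 2) := by positivity
  have h1 : ∫ z, nPdf z * nCdf (α * z + b) = ∫ z, nCdf (α * z + b) ∂(gaussianReal 0 1) := by
    rw [integral_gaussianReal_eq_integral_smul (by norm_num)]
    simp [nPdf_eq]
  have h2 : (gaussianReal 0 1).real (Set.Iio (b / Real.sqrt (1 + α ^ 2))) =
      (gaussianReal 0 (1 + NNReal.mk (α ^ 2) (sq_nonneg _))).real (Set.Iio b) := by
    have := gaussianReal_map_const_mul (μ := 0) (v := 1) (Real.sqrt (1 + α ^ 2))
    have e : (NNReal.mk ((Real.sqrt (1 + α ^ 2)) ^ 2) (sq_nonneg _) * 1 : NNReal)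
        = 1 + NNReal.mk (α ^ 2) (sq_nonneg _) := by
      ext; push_cast; rw [mul_one]; exact Real.sq_sqrt (by positivity)
    rw [e, mul_zero] at this
    rw [← this, map_measureReal_apply (by fun_prop) measurableSet_Iio]
    congr 1
    ext y; simp [lt_div_iff₀ hs, mul_comm]
  have h3 : gaussianReal 0 (1 + NNReal.mk (α ^ 2) (sq_nonneg _)) =
      ((gaussianReal 0 1).prod (gaussianReal 0 1)).map (fun p : ℝ × ℝ => p.2 + (-α) * p.1) := by
    have hm := gaussianReal_map_const_mul (μ := 0) (v := 1) (-α)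
    have e : (NNReal.mk ((-α) ^ 2) (sq_nonneg _) * 1 : NNReal) = NNReal.mk (α ^ 2) (sq_nonneg _) := by
      ext; simp
    rw [e, mul_zero] at hm
    have hc := gaussianReal_conv_gaussianReal (m₁ := 0) (m₂ := 0)
      (v₁ := NNReal.mk (α ^ 2) (sq_nonneg _)) (v₂ := 1)
    rw [add_zero, add_comm (_ : NNReal) 1] at hc
    rw [← hc, ← hm, Measure.conv]
    conv_lhs => rw [← Measure.map_id (μ := gaussianReal 0 1)]
    rw [Measure.map_map (by fun_prop) (by fun_prop)] 
    rw [Measure.map_prod_map _ _ (by fun_prop) (by fun_prop), Measure.map_map (by fun_prop) (by fun_prop)]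
    congr 1
    ext p; simp [add_comm]
  rw [h1, nCdf_eq, h2, h3, map_measureReal_apply (by fun_prop) measurableSet_Iio, measureReal_def,
    Measure.prod_apply (measurableSet_Iio.preimage (by fun_prop)),
    integral_eq_lintegral_of_nonneg_ae]
  · congr 1
    apply lintegral_congr
    intro z
    rw [nCdf_eq, ofReal_measureReal]
    congr 1
    ext w
    simp [add_comm]
  · exact Eventually.of_forall fun z => nCdf_nonneg _
  · exact (nCdf_cont.comp (by fun_prop)).aestronglyMeasurable

theorem gw_int {ν : ℝ} (hν : 0 < ν) :
    IntegrableOn (fun v : ℝ => v ^ (ν / 2 - 1) * Real.exp (-v)) (Set.Ioi 0) := by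
  have := Real.GammaIntegral_convergent (s := ν / 2) (by positivity)
  simpa [mul_comm] using this

theorem nct_int {ν : ℝ} (hν : 0 < ν) (x a : ℝ) :
    IntegrableOn (fun v : ℝ => v ^ (ν / 2 - 1) * Real.exp (-v) / Real.Gamma (ν / 2) *
      nCdf (x * Real.sqrt (2 * v / ν) - a)) (Set.Ioi 0) := by
  refine ((gw_int hν).div_const _).mul_bdd (c := 1) ?_ ?_
  · exact (nCdf_cont.comp (by fun_prop)).aestronglyMeasurable
  · exact Eventually.of_forall fun v => by
      rw [Real.norm_of_nonneg (nCdf_nonneg _)]; exact nCdf_le_one _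

theorem nct_pos {ν : ℝ} (hν : 0 < ν) (x a : ℝ) : 0 < nctCdf x a ν := by
  unfold nctCdf
  have hp : ∀ v ∈ Set.Ioi (0:ℝ), 0 < v ^ (ν / 2 - 1) * Real.exp (-v) / Real.Gamma (ν / 2) *
      nCdf (x * Real.sqrt (2 * v / ν) - a) := fun v hv => by
    have : 0 < v := hv
    have := nCdf_pos (x * Real.sqrt (2 * v / ν) - a)
    have := Real.Gamma_pos_of_pos (show 0 < ν / 2 by positivity)
    positivity
  rw [setIntegral_pos_iff_support_of_nonneg_ae]
  · rw [Set.inter_eq_self_of_subset_right]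
    · simp
    · intro v hv; exact (hp v hv).ne'
  · filter_upwards [ae_restrict_mem measurableSet_Ioi] with v hv using (hp v hv).le
  · exact nct_int hν x a

theorem nct_cont {ν : ℝ} (hν : 0 < ν) (a : ℝ) : Continuous fun x => nctCdf x a ν := by
  unfold nctCdf
  have hG := Real.Gamma_pos_of_pos (show 0 < ν / 2 by positivity)
  refine continuous_of_dominated (bound := fun v => v ^ (ν / 2 - 1) * Real.exp (-v) / Real.Gamma (ν / 2)) ?_ ?_ ?_ ?_
  · intro x; exact (nct_int hν x a).aestronglyMeasurable
  · intro x
    filter_upwards [ae_restrict_mem measurableSet_Ioi] with v hv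
    have : 0 < v := hv
    have h0 := nCdf_nonneg (x * Real.sqrt (2 * v / ν) - a)
    rw [Real.norm_of_nonneg (by positivity)]
    exact mul_le_of_le_one_right (by positivity) (nCdf_le_one _)
  · exact (gw_int hν).div_const _
  · exact Eventually.of_forall fun v => continuous_const.mul (nCdf_cont.comp (by fun_prop))

theorem nct_le_one {ν : ℝ} (hν : 0 < ν) (x a : ℝ) : nctCdf x a ν ≤ 1 := by
  have hG := Real.Gamma_pos_of_pos (show 0 < ν / 2 by positivity)
  have e : ∫ v in Set.Ioi (0:ℝ), v ^ (ν / 2 - 1) * Real.exp (-v) / Real.Gamma (ν / 2) = 1 := by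
    rw [integral_div, div_eq_one_iff_eq hG.ne', Real.Gamma_eq_integral (by positivity)]
    simp only [mul_comm]
  rw [← e]
  refine setIntegral_mono_on (nct_int hν x a) ((gw_int hν).div_const _) measurableSet_Ioi ?_
  intro v hv
  have : 0 < v := hv
  exact mul_le_of_le_one_right (by positivity) (nCdf_le_one _)

theorem inner_u {ν : ℝ} (hν : 1 < ν) (α τ κ u : ℝ) :
    Real.Gamma ((ν + 1) / 2) * (1 + u ^ 2 / ν) ^ (-(ν + 1) / 2) /
        (Real.Gamma (ν / 2) * Real.sqrt (ν * π)) *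
      nctCdf ((α * u + τ) * Real.sqrt ((ν + 1) / (ν + u ^ 2))) κ (ν + 1) =
    ∫ w in Set.Ioi (0:ℝ), (Real.Gamma (ν / 2) * Real.sqrt (ν * π))⁻¹ *
      (w ^ ((ν + 1) / 2 - 1) * Real.exp (-(w * (1 + u ^ 2 / ν))) *
        nCdf ((α * u + τ) * Real.sqrt (2 * w / ν) - κ)) := by
  have h0 : 0 < ν := by linarith
  have hb : 0 < 1 + u ^ 2 / ν := by positivity
  have hG := Real.Gamma_pos_of_pos (show 0 < (ν + 1) / 2 by positivity)
  unfold nctCdf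
  have := integral_comp_mul_left_Ioi (fun v => v ^ ((ν + 1) / 2 - 1) * Real.exp (-v) /
    Real.Gamma ((ν + 1) / 2) * nCdf ((α * u + τ) * Real.sqrt ((ν + 1) / (ν + u ^ 2)) *
      Real.sqrt (2 * v / (ν + 1)) - κ)) 0 hb
  rw [mul_zero, smul_eq_mul, eq_comm, inv_mul_eq_iff_eq_mul₀ hb.ne'] at this
  rw [this, ← mul_assoc, ← integral_const_mul]
  refine setIntegral_congr_fun measurableSet_Ioi ?_
  intro w hw
  have hw : 0 < w := hw
  have e1 : (α * u + τ) * Real.sqrt ((ν + 1) / (ν + u ^ 2)) *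
      Real.sqrt (2 * ((1 + u ^ 2 / ν) * w) / (ν + 1)) = (α * u + τ) * Real.sqrt (2 * w / ν) := by
    rw [mul_assoc, ← Real.sqrt_mul (by positivity)]
    congr 2
    field_simp
  have e2 : (1 + u ^ 2 / ν) ^ (-(ν + 1) / 2) * (1 + u ^ 2 / ν) *
      (1 + u ^ 2 / ν) ^ ((ν + 1) / 2 - 1) = 1 := by
    rw [← Real.rpow_add_one hb.ne', ← Real.rpow_add hb]
    convert Real.rpow_zero _ using 2
    ring
  simp only
  rw [e1, Real.mul_rpow hb.le hw.le, mul_comm w (1 + u ^ 2 / ν)]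
  calc _ = ((1 + u ^ 2 / ν) ^ (-(ν + 1) / 2) * (1 + u ^ 2 / ν) *
      (1 + u ^ 2 / ν) ^ ((ν + 1) / 2 - 1)) * ((Real.Gamma (ν / 2) * Real.sqrt (ν * π))⁻¹ *
      (w ^ ((ν + 1) / 2 - 1) * Real.exp (-((1 + u ^ 2 / ν) * w)) *
        nCdf ((α * u + τ) * Real.sqrt (2 * w / ν) - κ))) := by
        field_simp
    _ = _ := by rw [e2, one_mul]

theorem gexp {ν w : ℝ} (hν : 0 < ν) (hw : 0 < w) (u : ℝ) :
    Real.exp (-(w * (1 + u ^ 2 / ν))) =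
      Real.exp (-w) * (Real.sqrt (2 * π) * nPdf (Real.sqrt (2 * w / ν) * u)) := by
  unfold nPdf
  rw [mul_inv_cancel_left₀ (by positivity), ← Real.exp_add, mul_pow, Real.sq_sqrt (by positivity)]
  congr 1
  field_simp
  ring

theorem wconst {ν w : ℝ} (hν : 0 < ν) (hw : 0 < w) :
    (Real.Gamma (ν / 2) * Real.sqrt (ν * π))⁻¹ * (w ^ ((ν + 1) / 2 - 1) *
      (Real.sqrt (2 * π) * (Real.sqrt (2 * w / ν))⁻¹)) = w ^ (ν / 2 - 1) / Real.Gamma (ν / 2) := by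
  have hG := Real.Gamma_pos_of_pos (show 0 < ν / 2 by positivity)
  have e1 : w ^ ((ν + 1) / 2 - 1) = w ^ (ν / 2 - 1) * Real.sqrt w := by
    rw [Real.sqrt_eq_rpow, ← Real.rpow_add hw]; congr 1; ring
  have e2 : Real.sqrt w * Real.sqrt (2 * π) = Real.sqrt (2 * w / ν) * Real.sqrt (ν * π) := by
    rw [← Real.sqrt_mul (by positivity), ← Real.sqrt_mul (by positivity)]
    congr 1; field_simp
  have h1 : 0 < Real.sqrt (2 * w / ν) := by positivity
  have h2 : 0 < Real.sqrt (ν * π) := by positivity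
  rw [e1]
  field_simp
  linear_combination e2

theorem inner_w {ν w : ℝ} (hν : 0 < ν) (hw : 0 < w) (α τ κ : ℝ) :
    ∫ u, (Real.Gamma (ν / 2) * Real.sqrt (ν * π))⁻¹ *
      (w ^ ((ν + 1) / 2 - 1) * Real.exp (-(w * (1 + u ^ 2 / ν))) *
        nCdf ((α * u + τ) * Real.sqrt (2 * w / ν) - κ)) =
    w ^ (ν / 2 - 1) * Real.exp (-w) / Real.Gamma (ν / 2) *
      nCdf (τ / Real.sqrt (1 + α ^ 2) * Real.sqrt (2 * w / ν) - κ / Real.sqrt (1 + α ^ 2)) := by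
  have hs : 0 < Real.sqrt (2 * w / ν) := by positivity
  have := Measure.integral_comp_mul_left
    (fun z => nPdf z * nCdf (α * z + (τ * Real.sqrt (2 * w / ν) - κ))) (Real.sqrt (2 * w / ν))
  rw [gauss_mix, smul_eq_mul, abs_of_pos (by positivity)] at this
  calc _ = ∫ u, ((Real.Gamma (ν / 2) * Real.sqrt (ν * π))⁻¹ * (w ^ ((ν + 1) / 2 - 1) *
        Real.exp (-w) * Real.sqrt (2 * π))) * (nPdf (Real.sqrt (2 * w / ν) * u) *
        nCdf (α * (Real.sqrt (2 * w / ν) * u) + (τ * Real.sqrt (2 * w / ν) - κ))) := by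
        congr 1; funext u
        rw [gexp hν hw, show α * (Real.sqrt (2 * w / ν) * u) + (τ * Real.sqrt (2 * w / ν) - κ) =
          (α * u + τ) * Real.sqrt (2 * w / ν) - κ by ring]
        ring
    _ = _ := by
        rw [integral_const_mul, this, mul_div_right_comm (w ^ (ν / 2 - 1)), ← wconst hν hw,
          show τ / Real.sqrt (1 + α ^ 2) * Real.sqrt (2 * w / ν) - κ / Real.sqrt (1 + α ^ 2) =
          (τ * Real.sqrt (2 * w / ν) - κ) / Real.sqrt (1 + α ^ 2) by ring]
        ring

theorem F_int {ν : ℝ} (hν : 1 < ν) (α τ κ : ℝ) :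
    Integrable (Function.uncurry fun (u w : ℝ) => (Real.Gamma (ν / 2) * Real.sqrt (ν * π))⁻¹ *
      (w ^ ((ν + 1) / 2 - 1) * Real.exp (-(w * (1 + u ^ 2 / ν))) *
        nCdf ((α * u + τ) * Real.sqrt (2 * w / ν) - κ)))
      ((volume : Measure ℝ).prod ((volume : Measure ℝ).restrict (Set.Ioi 0))) := by
  have h0 : 0 < ν := by linarith
  have hG := Real.Gamma_pos_of_pos (show 0 < ν / 2 by positivity)
  have hm : Measurable nCdf := nCdf_cont.measurable
  have hF : Measurable (Function.uncurry fun (u w : ℝ) =>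
      (Real.Gamma (ν / 2) * Real.sqrt (ν * π))⁻¹ *
      (w ^ ((ν + 1) / 2 - 1) * Real.exp (-(w * (1 + u ^ 2 / ν))) *
        nCdf ((α * u + τ) * Real.sqrt (2 * w / ν) - κ))) := by
    simp only [Function.uncurry_def]
    fun_prop
  rw [integrable_prod_iff' hF.aestronglyMeasurable]
  simp only [Function.uncurry_apply_pair]
  have hpos : ∀ w ∈ Set.Ioi (0:ℝ), ∀ u, ‖(Real.Gamma (ν / 2) * Real.sqrt (ν * π))⁻¹ *
      (w ^ ((ν + 1) / 2 - 1) * Real.exp (-(w * (1 + u ^ 2 / ν))) *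
        nCdf ((α * u + τ) * Real.sqrt (2 * w / ν) - κ))‖ =
      (Real.Gamma (ν / 2) * Real.sqrt (ν * π))⁻¹ *
      (w ^ ((ν + 1) / 2 - 1) * Real.exp (-(w * (1 + u ^ 2 / ν))) *
        nCdf ((α * u + τ) * Real.sqrt (2 * w / ν) - κ)) := by
    intro w hw u
    have hw : 0 < w := hw
    have := nCdf_nonneg ((α * u + τ) * Real.sqrt (2 * w / ν) - κ)
    exact Real.norm_of_nonneg (by positivity)
  constructor
  · filter_upwards [ae_restrict_mem measurableSet_Ioi] with w hw
    have hw : 0 < w := hw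
    refine Integrable.const_mul ?_ _
    refine Integrable.mul_bdd (c := 1) ?_ ?_ ?_
    · refine Integrable.const_mul ?_ _
      simp only [gexp h0 hw]
      refine Integrable.const_mul (Integrable.const_mul ?_ _) _
      exact nPdf_integrable.comp_mul_left' (by positivity)
    · exact (nCdf_cont.comp (by fun_prop)).aestronglyMeasurable
    · exact Eventually.of_forall fun v => by
        rw [Real.norm_of_nonneg (nCdf_nonneg _)]; exact nCdf_le_one _
  · refine (nct_int h0 (τ / Real.sqrt (1 + α ^ 2)) (κ / Real.sqrt (1 + α ^ 2))).congr ?_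
    filter_upwards [ae_restrict_mem measurableSet_Ioi] with w hw
    simp only [hpos w hw]
    exact (inner_w h0 hw α τ κ).symm

theorem dens_int {ν : ℝ} (hν : 1 < ν) (α τ κ : ℝ) :
    Integrable fun u : ℝ => Real.Gamma ((ν + 1) / 2) * (1 + u ^ 2 / ν) ^ (-(ν + 1) / 2) /
        (Real.Gamma (ν / 2) * Real.sqrt (ν * π)) *
      nctCdf ((α * u + τ) * Real.sqrt ((ν + 1) / (ν + u ^ 2))) κ (ν + 1) := by
  simp only [inner_u hν]
  exact (F_int hν α τ κ).integral_prod_left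

theorem dens_mass {ν : ℝ} (hν : 1 < ν) (α τ κ : ℝ) :
    ∫ u : ℝ, Real.Gamma ((ν + 1) / 2) * (1 + u ^ 2 / ν) ^ (-(ν + 1) / 2) /
        (Real.Gamma (ν / 2) * Real.sqrt (ν * π)) *
      nctCdf ((α * u + τ) * Real.sqrt ((ν + 1) / (ν + u ^ 2))) κ (ν + 1) =
      nctCdf (τ / Real.sqrt (1 + α ^ 2)) (κ / Real.sqrt (1 + α ^ 2)) ν := by
  simp only [inner_u hν]
  rw [integral_integral_swap (F_int hν α τ κ)]
  exact setIntegral_congr_fun measurableSet_Ioi fun w hw => inner_w (by linarith) hw α τ κ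

theorem tail_gen {ν L M : ℝ} (hν : 0 < ν) (f : ℝ → ℝ) (hf : Measurable f)
    (hM : ∀ u, 0 < u → |f u| ≤ M * u ^ (-(ν + 1)))
    (hL : Tendsto (fun u => u ^ (ν + 1) * f u) atTop (𝓝 L)) :
    Tendsto (fun x => x ^ ν * ∫ u in Set.Ioi x, f u) atTop (𝓝 (L / ν)) := by
  have hint : ∫ s in Set.Ioi (1:ℝ), L * s ^ (-(ν + 1)) = L / ν := by
    rw [integral_const_mul, integral_Ioi_rpow_of_lt (by linarith) one_pos]
    simp; field_simp
  rw [← hint]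
  have key : Tendsto (fun x => ∫ s in Set.Ioi (1:ℝ), x ^ (ν + 1) * f (x * s)) atTop
      (𝓝 (∫ s in Set.Ioi (1:ℝ), L * s ^ (-(ν + 1)))) := by
    refine tendsto_integral_filter_of_dominated_convergence (fun s => M * s ^ (-(ν + 1))) ?_ ?_ ?_ ?_
    · exact Eventually.of_forall fun x => by
        exact (by fun_prop : Measurable fun s => x ^ (ν + 1) * f (x * s)).aestronglyMeasurable
    · filter_upwards [eventually_gt_atTop 0] with x hx
      filter_upwards [ae_restrict_mem measurableSet_Ioi] with s hs
      have hs : 0 < s := one_pos.trans hs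
      rw [norm_mul, Real.norm_of_nonneg (by positivity), Real.norm_eq_abs]
      calc _ ≤ x ^ (ν + 1) * (M * (x * s) ^ (-(ν + 1))) := by
            gcongr; exact hM _ (by positivity)
        _ = x ^ (ν + 1) * x ^ (-(ν + 1)) * (M * s ^ (-(ν + 1))) := by
            rw [Real.mul_rpow hx.le hs.le]; ring
        _ = _ := by rw [← Real.rpow_add hx]; simp
    · exact (integrableOn_Ioi_rpow_of_lt (by linarith) one_pos).const_mul _
    · filter_upwards [ae_restrict_mem measurableSet_Ioi] with s hs
      have hs : 0 < s := one_pos.trans hs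
      have := (hL.comp (tendsto_id.atTop_mul_const hs)).mul_const (s ^ (-(ν + 1)))
      refine this.congr' ?_
      filter_upwards [eventually_gt_atTop 0] with x hx
      simp only [Function.comp, id]
      rw [Real.mul_rpow hx.le hs.le, Real.rpow_neg hs.le]
      have : 0 < s ^ (ν + 1) := by positivity
      field_simp
  refine key.congr' ?_
  filter_upwards [eventually_gt_atTop 0] with x hx
  rw [integral_const_mul, integral_comp_mul_left_Ioi f 1 hx, Real.rpow_add_one hx.ne', mul_one,
    smul_eq_mul]
  field_simp

theorem arg_lim {ν : ℝ} (hν : 1 < ν) (α τ : ℝ) :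
    Tendsto (fun u : ℝ => (α * u + τ) * Real.sqrt ((ν + 1) / (ν + u ^ 2))) atTop
      (𝓝 (α * Real.sqrt (ν + 1))) := by
  have hi : Tendsto (fun u : ℝ => u⁻¹) atTop (𝓝 0) := tendsto_inv_atTop_zero
  have : Tendsto (fun u : ℝ => (α + τ * u⁻¹) * Real.sqrt ((ν + 1) / (ν * u⁻¹ ^ 2 + 1))) atTop
      (𝓝 ((α + τ * 0) * Real.sqrt ((ν + 1) / (ν * 0 ^ 2 + 1)))) := by
    refine (tendsto_const_nhds.add (tendsto_const_nhds.mul hi)).mul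
      (Tendsto.sqrt (tendsto_const_nhds.div ?_ (by norm_num)))
    exact (tendsto_const_nhds.mul (hi.pow 2)).add tendsto_const_nhds
  simp only [mul_zero, add_zero, ne_eq, OfNat.ofNat_ne_zero, not_false_eq_true, zero_pow,
    zero_add, div_one] at this
  refine this.congr' ?_
  filter_upwards [eventually_gt_atTop 0] with u hu
  have h1 : (ν + 1) / (ν * u⁻¹ ^ 2 + 1) = u ^ 2 * ((ν + 1) / (ν + u ^ 2)) := by
    have : 0 < ν + u ^ 2 := by positivity
    field_simp
  rw [h1, Real.sqrt_mul (by positivity), Real.sqrt_sq hu.le]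
  field_simp

theorem pow_lim {ν : ℝ} (hν : 1 < ν) :
    Tendsto (fun u : ℝ => u ^ (ν + 1) * (1 + u ^ 2 / ν) ^ (-(ν + 1) / 2)) atTop
      (𝓝 (ν ^ ((ν + 1) / 2))) := by
  have hi : Tendsto (fun u : ℝ => u⁻¹) atTop (𝓝 0) := tendsto_inv_atTop_zero
  have h0 : 0 < ν := by linarith
  have : Tendsto (fun u : ℝ => (u⁻¹ ^ 2 + 1 / ν) ^ (-(ν + 1) / 2)) atTop
      (𝓝 ((0 ^ 2 + 1 / ν) ^ (-(ν + 1) / 2))) := by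
    refine Tendsto.rpow_const ((hi.pow 2).add tendsto_const_nhds) (Or.inl ?_)
    simp [h0.ne']
  have e : ((0:ℝ) ^ 2 + 1 / ν) ^ (-(ν + 1) / 2) = ν ^ ((ν + 1) / 2) := by
    rw [zero_pow two_ne_zero, zero_add, one_div, Real.inv_rpow h0.le, ← Real.rpow_neg h0.le]
    congr 1; ring
  rw [e] at this
  refine this.congr' ?_
  filter_upwards [eventually_gt_atTop 0] with u hu
  have h1 : 1 + u ^ 2 / ν = u ^ 2 * (u⁻¹ ^ 2 + 1 / ν) := by field_simp
  rw [h1, Real.mul_rpow (by positivity) (by positivity), ← mul_assoc, ← Real.rpow_natCast u 2,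
    ← Real.rpow_mul hu.le, ← Real.rpow_add hu]
  have : ν + 1 + ((2:ℕ):ℝ) * (-(ν + 1) / 2) = 0 := by push_cast; ring
  rw [this, Real.rpow_zero, one_mul]

theorem pow_bd {ν u : ℝ} (hν : 1 < ν) (hu : 0 < u) :
    (1 + u ^ 2 / ν) ^ (-(ν + 1) / 2) ≤ ν ^ ((ν + 1) / 2) * u ^ (-(ν + 1)) := by
  have h0 : 0 < ν := by linarith
  have e : ν ^ ((ν + 1) / 2) * u ^ (-(ν + 1)) = (u ^ 2 / ν) ^ (-(ν + 1) / 2) := by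
    rw [Real.div_rpow (by positivity) h0.le, ← Real.rpow_natCast u 2, ← Real.rpow_mul hu.le,
      neg_div, Real.rpow_neg h0.le, div_inv_eq_mul, mul_comm]
    congr 2; push_cast; ring
  rw [e]
  exact Real.rpow_le_rpow_of_nonpos (by positivity) (by linarith) (by linarith)

/-- tail behaviour of the univariate non-central extended skew-t
distribution: its survival function is regularly varying at `+∞` with index `-ν`. -/
theorem skewT_tail_regular_variation
    (α τ κ ν : ℝ) (hν : 1 < ν) :
    let t1 : ℝ → ℝ := fun u =>
      Real.Gamma ((ν + 1) / 2) * (1 + u ^ 2 / ν) ^ (-(ν + 1) / 2) /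
        (Real.Gamma (ν / 2) * Real.sqrt (ν * π))
    let Ψsk : ℝ → ℝ := fun x => ∫ u in Set.Iio x,
      t1 u * nctCdf ((α * u + τ) * Real.sqrt ((ν + 1) / (ν + u ^ 2))) κ (ν + 1) /
        nctCdf (τ / Real.sqrt (1 + α ^ 2)) (κ / Real.sqrt (1 + α ^ 2)) ν
    Tendsto (fun x : ℝ => x ^ ν * (1 - Ψsk x)) atTop
      (𝓝 (Real.Gamma ((ν + 1) / 2) * ν ^ ((ν - 2) / 2) *
          nctCdf (α * Real.sqrt (ν + 1)) κ (ν + 1) /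
        (Real.sqrt π * Real.Gamma (ν / 2) *
          nctCdf (τ / Real.sqrt (1 + α ^ 2)) (κ / Real.sqrt (1 + α ^ 2)) ν))) := by
  intro t1 Ψsk
  have h0 : 0 < ν := by linarith
  have hG := Real.Gamma_pos_of_pos (show 0 < ν / 2 by positivity)
  have hG1 := Real.Gamma_pos_of_pos (show 0 < (ν + 1) / 2 by positivity)
  set D := nctCdf (τ / Real.sqrt (1 + α ^ 2)) (κ / Real.sqrt (1 + α ^ 2)) ν with hD
  have hDpos : 0 < D := nct_pos h0 _ _
  set f : ℝ → ℝ := fun u => t1 u *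
    nctCdf ((α * u + τ) * Real.sqrt ((ν + 1) / (ν + u ^ 2))) κ (ν + 1) with hf
  have hfi : Integrable f := dens_int hν α τ κ
  have hfm : ∫ u, f u = D := dens_mass hν α τ κ
  have hnm := (nct_cont (show 0 < ν + 1 by linarith) κ).measurable
  have hmeas : Measurable f := by
    have h2 : Measurable fun u : ℝ =>
        nctCdf ((α * u + τ) * Real.sqrt ((ν + 1) / (ν + u ^ 2))) κ (ν + 1) :=
      hnm.comp (by fun_prop)
    exact (by fun_prop : Measurable t1).mul h2
  have hlim := tail_gen (f := f) h0 hmeas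
    (M := Real.Gamma ((ν + 1) / 2) * ν ^ ((ν + 1) / 2) / (Real.Gamma (ν / 2) * Real.sqrt (ν * π)))
    (L := Real.Gamma ((ν + 1) / 2) * ν ^ ((ν + 1) / 2) / (Real.Gamma (ν / 2) * Real.sqrt (ν * π)) *
      nctCdf (α * Real.sqrt (ν + 1)) κ (ν + 1)) ?_ ?_
  rotate_left
  · intro u hu
    have hn := nct_pos (show 0 < ν + 1 by linarith)
      ((α * u + τ) * Real.sqrt ((ν + 1) / (ν + u ^ 2))) κ
    have hn1 := nct_le_one (show 0 < ν + 1 by linarith)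
      ((α * u + τ) * Real.sqrt ((ν + 1) / (ν + u ^ 2))) κ
    have ht : 0 ≤ t1 u := by simp only [t1]; positivity
    rw [abs_of_nonneg (mul_nonneg ht hn.le)]
    refine (mul_le_of_le_one_right ht hn1).trans ?_
    simp only [t1]
    rw [div_mul_eq_mul_div, mul_assoc]
    gcongr
    exact pow_bd hν hu
  · have h1 := ((nct_cont (show 0 < ν + 1 by linarith) κ).tendsto _).comp (arg_lim hν α τ)
    have h2 := ((pow_lim hν).const_mul (Real.Gamma ((ν + 1) / 2))).div_const
      (Real.Gamma (ν / 2) * Real.sqrt (ν * π))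
    refine (h2.mul h1).congr ?_
    intro u
    simp only [hf, t1, Function.comp]
    ring
  have hc := hlim.div_const D
  have hconst : Real.Gamma ((ν + 1) / 2) * ν ^ ((ν + 1) / 2) /
      (Real.Gamma (ν / 2) * Real.sqrt (ν * π)) *
      nctCdf (α * Real.sqrt (ν + 1)) κ (ν + 1) / ν / D = Real.Gamma ((ν + 1) / 2) *
      ν ^ ((ν - 2) / 2) * nctCdf (α * Real.sqrt (ν + 1)) κ (ν + 1) /
        (Real.sqrt π * Real.Gamma (ν / 2) * D) := by
    have e : ν ^ ((ν + 1) / 2) = ν ^ ((ν - 2) / 2) * Real.sqrt ν * ν := by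
      rw [Real.sqrt_eq_rpow, ← Real.rpow_add h0, ← Real.rpow_add_one h0.ne']
      congr 1; ring
    have hs : 0 < Real.sqrt ν := by positivity
    have hp : 0 < Real.sqrt π := by positivity
    rw [e, Real.sqrt_mul h0.le]
    field_simp
  rw [hconst] at hc
  refine hc.congr ?_
  intro x
  have hsplit : (∫ u in Set.Iio x, f u) + ∫ u in Set.Ioi x, f u = D := by
    rw [← hfm, ← integral_Iic_eq_integral_Iio]
    exact intervalIntegral.integral_Iic_add_Ioi hfi.integrableOn hfi.integrableOn
  have hΨ : Ψsk x = (∫ u in Set.Iio x, f u) / D := by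
    rw [← integral_div]
  rw [hΨ, eq_sub_of_add_eq' hsplit]
  field_simp
end
end

section
/- For every ν > 0 and α, τ ∈ ℝ, ∫_0^∞ y^ν φ(y) Φ(α y + τ) dy = 2^{(ν−2)/2} Γ((ν+1)/2) π^{−1/2} Ψ( α √(ν+1); −τ, ν+1 ); that is, the ν-th positive moment of the standard normal density multiplied by the shifted normal distribution function Φ(αy+τ) is given explicitly in terms of the univariate non-central t distribution function with non-centrality −τ and ν+1 degrees of freedom. -/
open MeasureTheory Real Filter Matrix Set Topology Asymptotics

noncomputable section

/-- the `ν`-th positive moment of the standard normal density weighted by a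
shifted normal distribution function, in terms of the non-central t distribution function. -/
theorem normal_moment_skew
    (ν α τ : ℝ) (hν : 0 < ν) :
    (∫ y in Set.Ioi (0 : ℝ), y ^ ν * nPdf y * nCdf (α * y + τ)) =
      2 ^ ((ν - 2) / 2) * Real.Gamma ((ν + 1) / 2) * (Real.sqrt π)⁻¹ *
        nctCdf (α * Real.sqrt (ν + 1)) (-τ) (ν + 1) := by
  have hsub : ∀ g : ℝ → ℝ, (∫ v in Set.Ioi (0 : ℝ), g v) =
      ∫ y in Set.Ioi (0 : ℝ), y * g (2⁻¹ * y ^ 2) := by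
    intro g
    have h1 := integral_comp_mul_left_Ioi g 0 (b := (2⁻¹ : ℝ)) (by norm_num)
    have h2 := integral_comp_rpow_Ioi_of_pos (g := fun y => g (2⁻¹ * y)) (p := 2) (by norm_num)
    rw [h1] at h2
    simp only [smul_eq_mul, mul_zero, inv_inv] at h2
    have h3 : (∫ x in Set.Ioi (0 : ℝ), 2 * x ^ ((2 : ℝ) - 1) * g (2⁻¹ * x ^ (2 : ℝ))) =
        2 * ∫ y in Set.Ioi (0 : ℝ), y * g (2⁻¹ * y ^ 2) := by
      rw [← integral_const_mul]
      refine setIntegral_congr_fun measurableSet_Ioi fun y _ => ?_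
      have e : (2 : ℝ) - 1 = 1 := by norm_num
      simp only [e, rpow_one, rpow_two]
      ring
    linarith
  unfold nctCdf
  rw [hsub (fun v => v ^ ((ν + 1) / 2 - 1) * Real.exp (-v) / Real.Gamma ((ν + 1) / 2) *
      nCdf (α * Real.sqrt (ν + 1) * Real.sqrt (2 * v / (ν + 1)) - -τ)), ← integral_const_mul]
  refine setIntegral_congr_fun measurableSet_Ioi fun y hy => ?_
  have hy : 0 < y := hy
  have hG : Real.Gamma ((ν + 1) / 2) ≠ 0 := (Real.Gamma_pos_of_pos (by linarith)).ne'
  have ha : α * Real.sqrt (ν + 1) * Real.sqrt (2 * (2⁻¹ * y ^ 2) / (ν + 1)) - -τ = α * y + τ := by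
    have e : 2 * (2⁻¹ * y ^ 2) / (ν + 1) = y ^ 2 / (ν + 1) := by ring
    have hs : Real.sqrt (ν + 1) ≠ 0 := (Real.sqrt_pos.2 (by linarith)).ne'
    rw [e, Real.sqrt_div (by positivity), Real.sqrt_sq hy.le]
    field_simp
    ring
  have hp : ((2⁻¹ * y ^ 2 : ℝ)) ^ ((ν + 1) / 2 - 1) * y = y ^ ν * 2 ^ (-((ν - 1) / 2)) := by
    rw [Real.mul_rpow (by norm_num) (by positivity), Real.inv_rpow (by norm_num),
      ← Real.rpow_neg (by norm_num), ← Real.rpow_natCast y 2, ← Real.rpow_mul hy.le, mul_assoc]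
    nth_rewrite 2 [← Real.rpow_one y]
    rw [← Real.rpow_add hy, mul_comm]
    congr 2 <;> push_cast <;> ring
  have hc : (2 : ℝ) ^ ((ν - 2) / 2) * 2 ^ (-((ν - 1) / 2)) = (Real.sqrt 2)⁻¹ := by
    rw [← Real.rpow_add (by norm_num), Real.sqrt_eq_rpow, ← Real.rpow_neg (by norm_num)]
    congr 1; ring
  have he : -(y ^ 2) / 2 = -(2⁻¹ * y ^ 2) := by ring
  simp only [ha, nPdf, he]
  rw [Real.sqrt_mul (by norm_num), mul_inv, ← hc]
  generalize nCdf (α * y + τ) = N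
  generalize Real.exp (-(2⁻¹ * y ^ 2)) = E
  calc _ = 2 ^ ((ν - 2) / 2) * (Real.sqrt π)⁻¹ * E * N * (y ^ ν * 2 ^ (-((ν - 1) / 2))) := by ring
    _ = _ := by
      rw [← hp]
      field_simp
end
end
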